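/- Let G be a finite group such that the centralizer C_G(x) is abelian for every non-identity element x ∈ G. Then G is a CG-group if and only if G is a Frobenius group with abelian kernel and cyclic complement, i.e., there exist subgroups K and H of G such that G is a Frobenius group with kernel K and complement H, K is abelian, and H is cyclic. -/

import Mathlib

/-- The set of element centralizers of a group `G`. -/
def Cent (G : Type*) [Group G] : Set (Subgroup G) :=
  Set.range fun x : G => Subgroup.centralizer {x}

/-- A finite group `G` is a CG-group if `|Cent(G)| = |G'| + 2`,
where `G'` is the commutator subgroup. -/
def IsCGGroup (G : Type*) [Group G] : Prop :=
  (Cent G).ncard = Nat.card (commutator G) + 2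

/-- `G` is a Frobenius group with kernel `K` and complement `H`: `K` is a nontrivial
proper normal subgroup, `H` is a nontrivial subgroup, `K ∩ H = 1`, `KH = G`, and the
centralizer of every nonidentity element of `K` is contained in `K`. -/
def IsFrobeniusGroupWith (G : Type*) [Group G] (K H : Subgroup G) : Prop :=
  K ≠ ⊥ ∧ K ≠ ⊤ ∧ K.Normal ∧ H ≠ ⊥ ∧ K ⊓ H = ⊥ ∧
    (∀ g : G, ∃ k ∈ K, ∃ h ∈ H, g = k * h) ∧
    ∀ k ∈ K, k ≠ 1 → Subgroup.centralizer {k} ≤ K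

/-- A finite abelian group with a fixed-point-free action on a nontrivial abelian group is
cyclic. -/
theorem isCyclic_of_fixedPointFree {H M : Type*} [CommGroup H] [Finite H] [AddCommGroup M]
    [Nontrivial M] (ρ : H →* Module.End ℤ M)
    (hρ : ∀ h m, ρ h m = m → m ≠ 0 → h = 1) : IsCyclic H := by
  let R := MonoidAlgebra ℤ H
  let φ : R →ₐ[ℤ] Module.End ℤ M := MonoidAlgebra.lift ℤ _ H ρ
  let _ : Module R M := Module.compHom M φ.toRingHom
  have hsmul (r : R) (m : M) : r • m = φ r m := rfl
  have : IsNoetherianRing R := by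
    have : Module.Finite ℤ R := inferInstanceAs (Module.Finite ℤ (MonoidAlgebra ℤ H))
    exact isNoetherian_of_tower ℤ (isNoetherian_of_isNoetherianRing_of_finite ℤ R)
  obtain ⟨P, hP⟩ := associatedPrimes.nonempty R M
  obtain ⟨hprime, m, hm⟩ := isAssociatedPrime_iff.mp hP
  have hmem (r : R) : r ∈ P ↔ r • m = 0 := by simp [hm, Submodule.mem_colon_singleton]
  have hm0 : m ≠ 0 := by
    rintro rfl
    exact hprime.ne_top ((Ideal.eq_top_iff_one P).mpr ((hmem 1).mpr (smul_zero _)))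
  refine isCyclic_of_injective_ringHom
    (((Ideal.Quotient.mk P : R →+* R ⧸ P) : R →* R ⧸ P).comp (MonoidAlgebra.of ℤ H)) ?_
  rw [injective_iff_map_eq_one]
  intro h hh
  have h1 : MonoidAlgebra.of ℤ H h - 1 ∈ P := by
    rw [← Ideal.Quotient.eq_zero_iff_mem, map_sub, map_one, sub_eq_zero]
    exact hh
  rw [hmem, sub_smul, one_smul, sub_eq_zero, hsmul] at h1
  exact hρ h m ((LinearMap.congr_fun (MonoidAlgebra.lift_of ρ h) m).symm.trans h1) hm0

section

variable {G : Type*} [Group G]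

theorem mem_centralizer_singleton_iff_commute {x z : G} :
    z ∈ Subgroup.centralizer ({x} : Set G) ↔ Commute x z := by
  simp [Subgroup.mem_centralizer_iff, Commute, SemiconjBy]

theorem commute_conj_iff {g x y : G} :
    Commute (g * x * g⁻¹) (g * y * g⁻¹) ↔ Commute x y := by
  simp

theorem commute_of_conj_eq_conj {g h a : G} (hgh : g * a * g⁻¹ = h * a * h⁻¹) :
    Commute a (h⁻¹ * g) := by
  have h1 : a = h⁻¹ * (g * a * g⁻¹) * h := by rw [hgh]; group
  change a * (h⁻¹ * g) = h⁻¹ * g * a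
  conv_lhs => rw [h1]
  group

theorem commute_of_commutator_eq {n a b : G} (h : a * n * a⁻¹ * n⁻¹ = b * n * b⁻¹ * n⁻¹) :
    Commute n (b⁻¹ * a) :=
  commute_of_conj_eq_conj (mul_right_cancel h)

theorem exists_eq_commutator_of_mem [Finite G] (A : Subgroup G) (n : G)
    (hA : ∀ a ∈ A, a * n * a⁻¹ * n⁻¹ ∈ A) (hn : ∀ a ∈ A, Commute n a → a = 1) {x : G}
    (hx : x ∈ A) : ∃ a ∈ A, x = a * n * a⁻¹ * n⁻¹ := by
  have hinj : Function.Injective fun a : A => (⟨_, hA a a.2⟩ : A) := by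
    intro a b hab
    have h := hn _ (A.mul_mem (A.inv_mem b.2) a.2)
      (commute_of_commutator_eq (congrArg Subtype.val hab))
    exact Subtype.ext (inv_mul_eq_one.mp h).symm
  obtain ⟨a, ha⟩ := (Finite.injective_iff_surjective.mp hinj) ⟨x, hx⟩
  exact ⟨a, a.2, (congrArg Subtype.val ha).symm⟩

namespace IsFrobeniusGroupWith

variable {K H : Subgroup G}

theorem eq_one_of_commute (hF : IsFrobeniusGroupWith G K H) {k h : G} (hk : k ∈ K) (hh : h ∈ H)
    (hh1 : h ≠ 1) (hc : Commute k h) : k = 1 := by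
  by_contra hk1
  have h1 : h ∈ K ⊓ H :=
    ⟨hF.2.2.2.2.2.2 k hk hk1 (mem_centralizer_singleton_iff_commute.mpr hc), hh⟩
  rw [hF.2.2.2.2.1] at h1
  exact hh1 h1

theorem exists_eq_commutator [Finite G] (hF : IsFrobeniusGroupWith G K H) {k h : G} (hk : k ∈ K)
    (hh : h ∈ H) (hh1 : h ≠ 1) : ∃ a ∈ K, k = a * h * a⁻¹ * h⁻¹ := by
  refine exists_eq_commutator_of_mem K h (fun a ha => ?_)
    (fun a ha hc => hF.eq_one_of_commute ha hh hh1 hc.symm) hk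
  have := K.mul_mem ha (hF.2.2.1.conj_mem _ (K.inv_mem ha) h)
  simpa [mul_assoc] using this

theorem commutator_eq [Finite G] (hF : IsFrobeniusGroupWith G K H)
    (hH : ∀ x ∈ H, ∀ y ∈ H, x * y = y * x) : commutator G = K := by
  have := hF.2.2.1
  obtain ⟨h, hh, hh1⟩ := H.bot_or_exists_ne_one.resolve_left hF.2.2.2.1
  apply le_antisymm
  · rw [commutator_def, Subgroup.commutator_le]
    intro a _ b _
    obtain ⟨k, hk, u, hu, rfl⟩ := hF.2.2.2.2.2.1 a
    obtain ⟨l, hl, v, hv, rfl⟩ := hF.2.2.2.2.2.1 b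
    rw [← QuotientGroup.eq_one_iff, commutatorElement_def]
    simp only [QuotientGroup.mk_mul, QuotientGroup.mk_inv, (QuotientGroup.eq_one_iff _).mpr hk,
      (QuotientGroup.eq_one_iff _).mpr hl, one_mul]
    rw [← QuotientGroup.mk_mul, hH u hu v hv]
    simp [mul_assoc]
  · intro k hk
    obtain ⟨a, -, rfl⟩ := hF.exists_eq_commutator hk hh hh1
    exact Subgroup.commutator_mem_commutator (Subgroup.mem_top a) (Subgroup.mem_top h)

theorem commute_iff_mem (hF : IsFrobeniusGroupWith G K H)
    (hH : ∀ x ∈ H, ∀ y ∈ H, x * y = y * x) {h z : G} (hh : h ∈ H) (hh1 : h ≠ 1) :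
    Commute h z ↔ z ∈ H := by
  refine ⟨fun hc => ?_, hH h hh z⟩
  obtain ⟨k, hk, u, hu, rfl⟩ := hF.2.2.2.2.2.1 z
  have h1 : Commute h k := by
    have := hc.mul_right (Commute.inv_right (hH h hh u hu : Commute h u))
    simpa using this
  simpa [hF.eq_one_of_commute hk hh hh1 h1.symm] using hu

theorem isCGGroup [Finite G] (hF : IsFrobeniusGroupWith G K H)
    (hK : ∀ x ∈ K, ∀ y ∈ K, x * y = y * x) (hH : ∀ x ∈ H, ∀ y ∈ H, x * y = y * x) :
    IsCGGroup G := by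
  obtain ⟨h, hh, hh1⟩ := H.bot_or_exists_ne_one.resolve_left hF.2.2.2.1
  have hhK : h ∉ K := fun hhK => hh1 (by
    have : h ∈ K ⊓ H := ⟨hhK, hh⟩
    rwa [hF.2.2.2.2.1] at this)
  have hconj (k x : G) (hx : x ∈ H) (hx1 : x ≠ 1) (z : G) :
      z ∈ Subgroup.centralizer {k * x * k⁻¹} ↔ k⁻¹ * z * k ∈ H := by
    rw [mem_centralizer_singleton_iff_commute, ← hF.commute_iff_mem hH hx hx1,
      ← commute_conj_iff (g := k) (x := x)]
    simp [mul_assoc]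
  let f : K → Subgroup G := fun k => Subgroup.centralizer {(k : G) * h * (k : G)⁻¹}
  have hf : Function.Injective f := by
    intro k l hkl
    have h1 : (k : G) * h * (k : G)⁻¹ ∈ f l := by
      rw [← hkl]
      exact mem_centralizer_singleton_iff_commute.mpr (Commute.refl _)
    have h2 := (hconj _ h hh hh1 _).mp h1
    let m : G := (l : G)⁻¹ * k
    have hm : m ∈ K := K.mul_mem (K.inv_mem l.2) k.2
    have h3 : m * h * m⁻¹ * h⁻¹ ∈ K ⊓ H := by
      constructor
      · have := K.mul_mem hm (hF.2.2.1.conj_mem _ (K.inv_mem hm) h)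
        simpa [mul_assoc] using this
      · refine H.mul_mem ?_ (H.inv_mem hh)
        simpa [m, mul_assoc] using h2
    rw [hF.2.2.2.2.1, Subgroup.mem_bot] at h3
    have h4 : m = 1 := hF.eq_one_of_commute hm hh hh1 (by
      rw [mul_inv_eq_one, mul_inv_eq_iff_eq_mul] at h3
      exact h3)
    exact Subtype.ext (inv_mul_eq_one.mp h4).symm
  have hcent : Cent G = insert ⊤ (insert K (Set.range f)) := by
    have hCK (k : G) (hk : k ∈ K) (hk1 : k ≠ 1) : Subgroup.centralizer {k} = K :=
      le_antisymm (hF.2.2.2.2.2.2 k hk hk1) fun z hz =>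
        mem_centralizer_singleton_iff_commute.mpr (hK k hk z hz)
    apply Set.Subset.antisymm
    · rintro _ ⟨x, rfl⟩
      by_cases hx1 : x = 1
      · left
        ext z
        simp [hx1, mem_centralizer_singleton_iff_commute]
      right
      by_cases hx : x ∈ K
      · exact Or.inl (hCK x hx hx1)
      right
      obtain ⟨k, hk, u, hu, rfl⟩ := hF.2.2.2.2.2.1 x
      have hu1 : u ≠ 1 := by
        rintro rfl
        exact hx (by simpa using hk)
      obtain ⟨a, ha, rfl⟩ := hF.exists_eq_commutator hk hu hu1
      refine ⟨⟨a, ha⟩, ?_⟩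
      ext z
      simp only [f, inv_mul_cancel_right]
      rw [hconj _ _ hh hh1, hconj _ _ hu hu1]
    · rintro _ (rfl | rfl | ⟨k, rfl⟩)
      · exact ⟨1, by ext z; simp [mem_centralizer_singleton_iff_commute]⟩
      · obtain ⟨k, hk, hk1⟩ := Subgroup.bot_or_exists_ne_one _ |>.resolve_left hF.1
        exact ⟨k, hCK k hk hk1⟩
      · exact ⟨_, rfl⟩
  have hmem (k : K) : (k : G) * h * (k : G)⁻¹ ∈ f k :=
    mem_centralizer_singleton_iff_commute.mpr (Commute.refl _)
  have hKr : K ∉ Set.range f := by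
    rintro ⟨k, hk⟩
    have h1 := hmem k
    rw [hk] at h1
    exact hhK (by simpa [mul_assoc] using hF.2.2.1.conj_mem _ h1 (k : G)⁻¹)
  have htop : ⊤ ∉ insert K (Set.range f) := by
    rintro (hk | ⟨k, hk⟩)
    · exact hF.2.1 hk.symm
    · refine hF.1 ((Subgroup.eq_bot_iff_forall _).mpr fun x hx => ?_)
      have h1 : (k : G) * x * (k : G)⁻¹ ∈ f k := hk ▸ Subgroup.mem_top _
      rw [mem_centralizer_singleton_iff_commute, commute_conj_iff] at h1
      exact hF.eq_one_of_commute hx hh hh1 h1.symm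
  rw [IsCGGroup, hcent, Set.ncard_insert_of_notMem htop, Set.ncard_insert_of_notMem hKr,
    hF.commutator_eq hH, ← Nat.card_coe_set_eq, Nat.card_range_of_injective hf]

theorem isCyclic_complement [Finite G] (hF : IsFrobeniusGroupWith G K H)
    (hK : ∀ x ∈ K, ∀ y ∈ K, x * y = y * x) (hH : ∀ x ∈ H, ∀ y ∈ H, x * y = y * x) :
    IsCyclic H := by
  have := hF.2.2.1
  let _ : CommGroup K := { mul_comm := fun a b => Subtype.ext (hK a a.2 b b.2) }
  let _ : CommGroup H := { mul_comm := fun a b => Subtype.ext (hH a a.2 b b.2) }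
  have : Nontrivial K := (Subgroup.nontrivial_iff_ne_bot K).mpr hF.1
  let ρ : H →* Module.End ℤ (Additive K) :=
    { toFun := fun h =>
        (MonoidHom.toAdditive (MulAut.conjNormal (h : G)).toMonoidHom).toIntLinearMap
      map_one' := by ext k; simp
      map_mul' := fun a b => by ext k; simp }
  refine isCyclic_of_fixedPointFree ρ fun h m hm hm0 => ?_
  by_contra hh1
  apply hm0
  have h1 : (h : G) * (m.toMul : G) * (h : G)⁻¹ = (m.toMul : G) :=
    (MulAut.conjNormal_apply (h : G) m.toMul).symm.trans
      (congrArg (fun z : Additive K => (z.toMul : G)) hm)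
  have h2 := hF.eq_one_of_commute m.toMul.2 h.2 (by simpa using hh1)
    (mul_inv_eq_iff_eq_mul.mp h1).symm
  exact congrArg Additive.ofMul (Subtype.ext h2 : m.toMul = 1)

end IsFrobeniusGroupWith

/-- Commuting is transitive through nonidentity elements. -/
def CommuteTransitive (G : Type*) [Group G] : Prop :=
  ∀ a b c : G, b ≠ 1 → Commute a b → Commute b c → Commute a c

/-- The nonidentity elements which commute with some conjugate of `x`. -/
def conjCentralizer (x : G) : Set G :=
  {z | z ≠ 1 ∧ ∃ g, Commute (g * x * g⁻¹) z}

namespace CommuteTransitive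

theorem centralizer_eq (hT : CommuteTransitive G) {x y : G} (hx : x ≠ 1) (hy : y ≠ 1)
    (h : Commute x y) :
    Subgroup.centralizer ({x} : Set G) = Subgroup.centralizer ({y} : Set G) := by
  ext z
  simp only [mem_centralizer_singleton_iff_commute]
  exact ⟨hT y x z hx h.symm, hT x y z hy h⟩

theorem mem_commutator (hT : CommuteTransitive G) [Finite G] {x g : G} (hx : x ≠ 1)
    (hg : Commute (g * x * g⁻¹) x) (hxg : ¬Commute x g) : x ∈ commutator G := by
  have hgi (a : G) (ha : Commute x a) : Commute x (g * a * g⁻¹) :=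
    hT _ (g * x * g⁻¹) _ (by simpa using hx) hg.symm (commute_conj_iff.mpr ha)
  obtain ⟨a, -, ha⟩ := exists_eq_commutator_of_mem (Subgroup.centralizer ({x} : Set G)) g
    (x := x) (fun a ha => by
      rw [mem_centralizer_singleton_iff_commute] at ha ⊢
      have := ha.mul_right (hgi _ ha.inv_right)
      simpa [mul_assoc] using this)
    (fun a ha hga => by
      rw [mem_centralizer_singleton_iff_commute] at ha
      by_contra ha1
      exact hxg (hT x a g ha1 ha hga.symm))
    (mem_centralizer_singleton_iff_commute.mpr (Commute.refl x))
  rw [ha]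
  exact Subgroup.commutator_mem_commutator (Subgroup.mem_top a) (Subgroup.mem_top g)

variable {x : G}

theorem commute_of_commute_conj (hT : CommuteTransitive G)
    (hN : ∀ g, Commute (g * x * g⁻¹) x → Commute x g) {a b g h : G}
    (ha1 : a ≠ 1) (hb1 : b ≠ 1) (ha : Commute x a) (hb : Commute x b)
    (hab : Commute (g * a * g⁻¹) (h * b * h⁻¹)) : Commute x (h⁻¹ * g) := by
  have h1 : Commute (g * x * g⁻¹) (h * x * h⁻¹) :=
    hT _ (h * b * h⁻¹) _ (by simpa using hb1)
      (hT _ (g * a * g⁻¹) _ (by simpa using ha1) (commute_conj_iff.mpr ha) hab)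
      (commute_conj_iff.mpr hb.symm)
  apply hN
  rw [← commute_conj_iff (g := h)]
  simpa [mul_assoc] using h1

theorem quotient_eq_of_commute_conj (hT : CommuteTransitive G)
    (hN : ∀ g, Commute (g * x * g⁻¹) x → Commute x g) {a b : G}
    {c d : G ⧸ Subgroup.centralizer ({x} : Set G)}
    (ha1 : a ≠ 1) (hb1 : b ≠ 1) (ha : Commute x a) (hb : Commute x b)
    (hab : Commute (c.out * a * c.out⁻¹) (d.out * b * d.out⁻¹)) : c = d := by
  rw [← c.out_eq', ← d.out_eq', eq_comm]
  exact QuotientGroup.eq.mpr (mem_centralizer_singleton_iff_commute.mpr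
    (hT.commute_of_commute_conj hN ha1 hb1 ha hb hab))

theorem conj_out_eq (g a : G) (hT : CommuteTransitive G) (hx : x ≠ 1) (ha : Commute x a) :
    (g : G ⧸ Subgroup.centralizer ({x} : Set G)).out * a *
      (g : G ⧸ Subgroup.centralizer ({x} : Set G)).out⁻¹ = g * a * g⁻¹ := by
  obtain ⟨⟨h, hh⟩, hg⟩ := QuotientGroup.mk_out_eq_mul (Subgroup.centralizer ({x} : Set G)) g
  rw [hg]
  have h1 : a * h = h * a :=
    hT a x h hx ha.symm (mem_centralizer_singleton_iff_commute.mp hh)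
  have h2 : h * a * h⁻¹ = a := by rw [← h1]; simp
  calc g * h * a * (g * h)⁻¹ = g * (h * a * h⁻¹) * g⁻¹ := by group
    _ = _ := by rw [h2]

theorem conj_mem_conjCentralizer {a g : G} (ha1 : a ≠ 1) (ha : Commute x a) :
    g * a * g⁻¹ ∈ conjCentralizer x :=
  ⟨by simpa using ha1, g, commute_conj_iff.mpr ha⟩

theorem exists_conj_of_mem {z : G} (hz : z ∈ conjCentralizer x) :
    ∃ g a, a ≠ 1 ∧ Commute x a ∧ g * a * g⁻¹ = z := by
  obtain ⟨hz1, g, hg⟩ := hz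
  refine ⟨g, g⁻¹ * z * g, ?_, ?_, by group⟩
  · intro h
    apply hz1
    have : z = g * (g⁻¹ * z * g) * g⁻¹ := by group
    rw [this, h]; simp
  · rw [← commute_conj_iff (g := g)]
    simpa [mul_assoc] using hg

theorem ncard_conjCentralizer (hT : CommuteTransitive G) [Finite G] (hx : x ≠ 1)
    (hN : ∀ g, Commute (g * x * g⁻¹) x → Commute x g) :
    (conjCentralizer x).ncard = (Subgroup.centralizer ({x} : Set G)).index *
      (Nat.card (Subgroup.centralizer ({x} : Set G)) - 1) := by
  let A := Subgroup.centralizer ({x} : Set G)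
  let f : (G ⧸ A) × {a : A // a ≠ 1} → G := fun p => p.1.out * p.2.1 * p.1.out⁻¹
  have hmem (a : A) : Commute x a := mem_centralizer_singleton_iff_commute.mp a.2
  have hf : Function.Injective f := by
    rintro ⟨c, a, ha⟩ ⟨d, b, hb⟩ hab
    have hcd : c = d := hT.quotient_eq_of_commute_conj hN (by simpa using ha) (by simpa using hb)
      (hmem a) (hmem b) (by
        change Commute (f (c, ⟨a, ha⟩)) (f (d, ⟨b, hb⟩))
        rw [hab])
    subst hcd
    simpa [f] using hab
  have hrange : Set.range f = conjCentralizer x := by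
    apply Set.Subset.antisymm
    · rintro _ ⟨⟨c, a, ha⟩, rfl⟩
      exact conj_mem_conjCentralizer (by simpa using ha) (hmem a)
    · intro z hz
      obtain ⟨g, a, ha1, ha, rfl⟩ := exists_conj_of_mem hz
      exact ⟨⟨g, ⟨a, mem_centralizer_singleton_iff_commute.mpr ha⟩, by simpa using ha1⟩,
        conj_out_eq g a hT hx ha⟩
  have hcard : Nat.card {a : A // a ≠ 1} = Nat.card A - 1 := by
    classical
    have := Fintype.ofFinite A
    rw [Nat.card_eq_fintype_card, Nat.card_eq_fintype_card]
    exact Set.card_ne_eq (1 : A)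
  rw [← hrange, ← Nat.card_coe_set_eq, Nat.card_range_of_injective hf, Nat.card_prod, hcard]
  rfl

theorem ncard_compl_conjCentralizer (hT : CommuteTransitive G) [Finite G] (hx : x ≠ 1)
    (hN : ∀ g, Commute (g * x * g⁻¹) x → Commute x g) :
    (conjCentralizer x)ᶜ.ncard = (Subgroup.centralizer ({x} : Set G)).index := by
  have h1 := Set.ncard_add_ncard_compl (conjCentralizer x)
  rw [hT.ncard_conjCentralizer hx hN, ← Subgroup.index_mul_card
    (Subgroup.centralizer ({x} : Set G))] at h1
  obtain ⟨m, hm⟩ := Nat.exists_eq_succ_of_ne_zero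
    (Nat.card_pos (α := Subgroup.centralizer ({x} : Set G))).ne'
  rw [hm, Nat.succ_sub_one, Nat.mul_succ] at h1
  omega

theorem ncard_image_centralizer (hT : CommuteTransitive G) (hx : x ≠ 1)
    (hN : ∀ g, Commute (g * x * g⁻¹) x → Commute x g) :
    ((fun z : G => Subgroup.centralizer ({z} : Set G)) '' conjCentralizer x).ncard =
      (Subgroup.centralizer ({x} : Set G)).index := by
  let A := Subgroup.centralizer ({x} : Set G)
  let f : G ⧸ A → Subgroup G := fun c => Subgroup.centralizer {c.out * x * c.out⁻¹}
  have hf : Function.Injective f := by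
    intro c d hcd
    refine hT.quotient_eq_of_commute_conj hN hx hx (Commute.refl x) (Commute.refl x) ?_
    have h1 : d.out * x * d.out⁻¹ ∈ f d :=
      mem_centralizer_singleton_iff_commute.mpr (Commute.refl _)
    rw [← hcd] at h1
    exact mem_centralizer_singleton_iff_commute.mp h1
  have hrange : Set.range f =
      (fun z : G => Subgroup.centralizer ({z} : Set G)) '' conjCentralizer x := by
    apply Set.Subset.antisymm
    · rintro _ ⟨c, rfl⟩
      exact ⟨_, conj_mem_conjCentralizer hx (Commute.refl x), rfl⟩
    · rintro _ ⟨z, hz, rfl⟩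
      obtain ⟨g, a, ha1, ha, rfl⟩ := exists_conj_of_mem hz
      refine ⟨g, ?_⟩
      simp only [f]
      rw [conj_out_eq g x hT hx (Commute.refl x)]
      exact hT.centralizer_eq (by simpa using hx) (by simpa using ha1) (commute_conj_iff.mpr ha)
  rw [← hrange, ← Nat.card_coe_set_eq, Nat.card_range_of_injective hf]
  rfl

/-- A nonidentity element commuting with no conjugate of an element `x` having self-normalizing
centralizer lies in the commutator subgroup. -/
theorem mem_commutator_of_notMem_conjCentralizer (hT : CommuteTransitive G) [Finite G] (hx : x ≠ 1)
    (hN : ∀ g, Commute (g * x * g⁻¹) x → Commute x g) {y : G} (hy : y ∉ conjCentralizer x) :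
    y ∈ commutator G := by
  by_cases hy1 : y = 1
  · rw [hy1]
    exact one_mem _
  by_contra hyc
  have hNy (g : G) (hg : Commute (g * y * g⁻¹) y) : Commute y g := by
    by_contra h
    exact hyc (hT.mem_commutator hy1 hg h)
  have hsub : conjCentralizer y ⊆ (conjCentralizer x)ᶜ \ {1} := by
    intro z hz
    refine ⟨fun hzx => hy ?_, hz.1⟩
    obtain ⟨hz1, g, hg⟩ := hz
    obtain ⟨-, h, hh⟩ := hzx
    have h1 := hT _ z _ hz1 hh hg.symm
    refine ⟨hy1, g⁻¹ * h, ?_⟩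
    rw [← commute_conj_iff (g := g)]
    simpa [mul_assoc] using h1
  have h1 := Set.ncard_le_ncard hsub (Set.toFinite _)
  have h2 : (1 : G) ∈ (conjCentralizer x)ᶜ := fun h => h.1 rfl
  rw [Set.ncard_sdiff_singleton_of_mem h2, hT.ncard_compl_conjCentralizer hx hN] at h1
  have h3 := hT.ncard_compl_conjCentralizer hy1 hNy
  have h4 := Set.ncard_add_ncard_compl (conjCentralizer y)
  have h5 (w : G) (hw : w ≠ 1) : 2 * (Subgroup.centralizer ({w} : Set G)).index ≤ Nat.card G := by
    rw [← Subgroup.card_mul_index (Subgroup.centralizer ({w} : Set G))]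
    refine Nat.mul_le_mul_right _ ?_
    have : Nontrivial (Subgroup.centralizer ({w} : Set G)) :=
      ⟨⟨w, mem_centralizer_singleton_iff_commute.mpr (Commute.refl w)⟩, 1, by simpa using hw⟩
    exact Finite.one_lt_card
  have h6 := h5 x hx
  have h7 := h5 y hy1
  have h8 : 0 < (Subgroup.centralizer ({x} : Set G)).index :=
    Nat.pos_of_ne_zero Subgroup.index_ne_zero_of_finite
  omega

theorem exists_selfNormalizing (hT : CommuteTransitive G) [Finite G] (hCG : IsCGGroup G) :
    ∃ x : G, x ≠ 1 ∧ ∀ g, Commute (g * x * g⁻¹) x → Commute x g := by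
  by_contra! h
  have h1 : commutator G = ⊤ := by
    rw [eq_top_iff]
    intro x _
    by_cases hx : x = 1
    · rw [hx]
      exact one_mem _
    · obtain ⟨g, hg, hxg⟩ := h x hx
      exact hT.mem_commutator hx hg hxg
  have h2 : (Cent G).ncard ≤ Nat.card G := by
    rw [Cent, ← Nat.card_coe_set_eq]
    exact Finite.card_range_le _
  rw [hCG, h1, Subgroup.card_top] at h2
  omega

theorem exists_frobenius (hT : CommuteTransitive G) [Finite G] (hCG : IsCGGroup G) :
    ∃ K H : Subgroup G, IsFrobeniusGroupWith G K H ∧ (∀ x ∈ K, ∀ y ∈ K, x * y = y * x) ∧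
      ∀ x ∈ H, ∀ y ∈ H, x * y = y * x := by
  obtain ⟨x, hx, hN⟩ := hT.exists_selfNormalizing hCG
  let A := Subgroup.centralizer ({x} : Set G)
  let D := commutator G
  let C : G → Subgroup G := fun z => Subgroup.centralizer {z}
  let U := conjCentralizer x
  have h1U : (1 : G) ∈ Uᶜ := fun h => h.1 rfl
  have hUD : Uᶜ ⊆ (D : Set G) := fun y hy => hT.mem_commutator_of_notMem_conjCentralizer hx hN hy
  have hcU : Uᶜ.ncard = A.index := hT.ncard_compl_conjCentralizer hx hN
  have hcV : (C '' U).ncard = A.index := hT.ncard_image_centralizer hx hN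
  have hcent : Cent G = insert (C 1) (C '' U ∪ C '' (Uᶜ \ {1})) := by
    rw [← Set.image_union, ← Set.image_insert_eq, Cent, ← Set.image_univ]
    congr 1
    ext z
    by_cases h1 : z = 1 <;> by_cases h2 : z ∈ U <;> simp [h1, h2]
  have hnotTop (z : G) (hz : z ≠ 1) : C z ≠ C 1 := by
    intro h
    have hz' (w : G) : Commute z w := by
      have : w ∈ C 1 := mem_centralizer_singleton_iff_commute.mpr (Commute.one_left w)
      rw [← h] at this
      exact mem_centralizer_singleton_iff_commute.mp this
    have h1 : Cent G ⊆ {C 1} := by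
      rintro _ ⟨w, rfl⟩
      refine Subgroup.ext fun v => ?_
      simp only [C, mem_centralizer_singleton_iff_commute]
      exact ⟨fun _ => Commute.one_left v, fun _ => hT w z v hz (hz' w).symm (hz' v)⟩
    have h2 := Set.ncard_le_ncard h1 (Set.toFinite _)
    rw [hCG, Set.ncard_singleton] at h2
    omega
  have hUcomm (z y : G) (hz : z ∈ U) (hy : y ≠ 1) (hzy : Commute z y) : y ∈ U :=
    ⟨hy, hz.2.imp fun g hg => hT _ z _ hz.1 hg hzy⟩
  have hdisj : Disjoint (C '' U) (C '' (Uᶜ \ {1})) := by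
    rw [Set.disjoint_left]
    rintro _ ⟨z, hz, rfl⟩ ⟨y, ⟨hyU, hy1⟩, hyz⟩
    refine hyU (hUcomm z y hz hy1 (mem_centralizer_singleton_iff_commute.mp ?_))
    change y ∈ C z
    rw [← hyz]
    exact mem_centralizer_singleton_iff_commute.mpr (Commute.refl y)
  have hcard : Nat.card D + 2 = A.index + (C '' (Uᶜ \ {1})).ncard + 1 := by
    have h1 : (Cent G).ncard = Nat.card D + 2 := hCG
    rw [← h1, hcent, Set.ncard_insert_of_notMem, Set.ncard_union_eq hdisj, hcV]
    rintro (⟨z, hz, h⟩ | ⟨z, ⟨-, hz⟩, h⟩)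
    · exact hnotTop z hz.1 h
    · exact hnotTop z hz h
  have hcT : (C '' (Uᶜ \ {1})).ncard ≤ A.index - 1 := by
    rw [← hcU, ← Set.ncard_sdiff_singleton_of_mem h1U]
    exact Set.ncard_image_le
  have hAD (d : G) (hd : d ∈ D) (hdx : Commute x d) : d = 1 := by
    by_contra hd1
    let f : G ⧸ A → G := fun c => c.out * d * c.out⁻¹
    have hf : Function.Injective f := fun c c' hcc =>
      hT.quotient_eq_of_commute_conj hN hd1 hd1 hdx hdx (by
        change Commute (f c) (f c')
        rw [hcc])
    have h1 : Uᶜ ∪ Set.range f ⊆ (D : Set G) := by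
      refine Set.union_subset hUD ?_
      rintro _ ⟨c, rfl⟩
      exact Subgroup.Normal.conj_mem inferInstance d hd c.out
    have h2 : Disjoint Uᶜ (Set.range f) := by
      rw [Set.disjoint_left]
      rintro _ hU ⟨c, rfl⟩
      exact hU (conj_mem_conjCentralizer hd1 hdx)
    have h3 := Set.ncard_le_ncard h1 (Set.toFinite _)
    have h4 : (Set.range f).ncard = A.index := by
      rw [← Nat.card_coe_set_eq, Nat.card_range_of_injective hf]
      rfl
    rw [Set.ncard_union_eq h2, hcU, h4, ← Nat.card_coe_set_eq] at h3
    change _ ≤ Nat.card D at h3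
    omega
  have hDU (d : G) (hd : d ∈ D) : d ∉ U := by
    intro hdU
    obtain ⟨g, a, ha1, ha, rfl⟩ := exists_conj_of_mem hdU
    refine ha1 (hAD a ?_ ha)
    have := Subgroup.Normal.conj_mem (H := D) inferInstance _ hd g⁻¹
    simpa [mul_assoc] using this
  have hD : (D : Set G) = Uᶜ := Set.Subset.antisymm hDU hUD
  have hcD : Nat.card D = A.index := by
    rw [← hcU, ← hD]
    exact Nat.card_coe_set_eq _
  have hone : (C '' (Uᶜ \ {1})).ncard ≤ 1 := by omega
  have hxA : x ∈ A := mem_centralizer_singleton_iff_commute.mpr (Commute.refl x)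
  have hdisjAD : Disjoint D A := by
    rw [Subgroup.disjoint_def]
    exact fun {d} hd hdA => hAD d hd (mem_centralizer_singleton_iff_commute.mp hdA)
  have hcompl : Subgroup.IsComplement' D A :=
    Subgroup.isComplement'_of_card_mul_and_disjoint
      (by rw [hcD, Subgroup.index_mul_card]) hdisjAD
  refine ⟨D, A, ⟨?_, ?_, inferInstance, ?_, hdisjAD.eq_bot, ?_, ?_⟩, ?_, ?_⟩
  · intro hbot
    have h1 : A.index = 1 := by rw [← hcD, hbot]; simp
    rw [Subgroup.index_eq_one] at h1
    refine hnotTop x hx (h1.trans ?_)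
    symm
    rw [eq_top_iff]
    exact fun w _ => mem_centralizer_singleton_iff_commute.mpr (Commute.one_left w)
  · intro htop
    exact hx (hAD x (htop ▸ Subgroup.mem_top x) (Commute.refl x))
  · intro hbot
    rw [hbot] at hxA
    exact hx hxA
  · intro g
    obtain ⟨⟨k, h⟩, rfl⟩ := hcompl.2 g
    exact ⟨k, k.2, h, h.2, rfl⟩
  · intro k hk hk1 z hz
    rw [mem_centralizer_singleton_iff_commute] at hz
    refine hUD fun hzU => hDU k hk (hUcomm z k hzU hk1 hz.symm)
  · intro a ha b hb
    by_cases ha1 : a = 1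
    · simp [ha1]
    by_cases hb1 : b = 1
    · simp [hb1]
    have h1 : C a = C b := (Set.ncard_le_one (Set.toFinite _)).mp hone _
      ⟨a, ⟨hDU a ha, ha1⟩, rfl⟩ _ ⟨b, ⟨hDU b hb, hb1⟩, rfl⟩
    have h2 : b ∈ C a := by
      rw [h1]
      exact mem_centralizer_singleton_iff_commute.mpr (Commute.refl b)
    exact mem_centralizer_singleton_iff_commute.mp h2
  · intro a ha b hb
    rw [mem_centralizer_singleton_iff_commute] at ha hb
    exact hT a x b hx ha.symm hb

end CommuteTransitive

end

/-- If all centralizers of nonidentity elements of a finite group `G` are abelian, then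
`G` is a CG-group iff `G` is a Frobenius group with abelian kernel and cyclic
complement. -/
theorem isCGGroup_iff_frobenius_of_CA (G : Type*) [Group G] [Finite G]
    (hCA : ∀ x : G, x ≠ 1 →
      ∀ a ∈ Subgroup.centralizer ({x} : Set G), ∀ b ∈ Subgroup.centralizer ({x} : Set G),
        a * b = b * a) :
    IsCGGroup G ↔ ∃ K H : Subgroup G, IsFrobeniusGroupWith G K H ∧
      (∀ x ∈ K, ∀ y ∈ K, x * y = y * x) ∧ IsCyclic H := by
  constructor
  · intro hCG
    have hT : CommuteTransitive G := fun a b c hb hab hbc =>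
      hCA b hb a (mem_centralizer_singleton_iff_commute.mpr hab.symm) c
        (mem_centralizer_singleton_iff_commute.mpr hbc)
    obtain ⟨K, H, hF, hK, hH⟩ := hT.exists_frobenius hCG
    exact ⟨K, H, hF, hK, hF.isCyclic_complement hK hH⟩
  · rintro ⟨K, H, hF, hK, hcyc⟩
    refine hF.isCGGroup hK fun a ha b hb => ?_
    let _ : CommGroup H := IsCyclic.commGroup
    exact congrArg Subtype.val (mul_comm (⟨a, ha⟩ : H) ⟨b, hb⟩)
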